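/- Composition of Rényi differential privacy for independent mechanisms: let I be a finite index set, and for each i ∈ I let Pᵢ and Qᵢ be probability measures on a measurable space αᵢ with Pᵢ ≪ Qᵢ. Fix λ > 1 and εᵢ ≥ 0 with ∫ (dPᵢ/dQᵢ)^λ dQᵢ ≤ exp((λ−1)εᵢ) for each i. Then the product measures P = ⊗ᵢ Pᵢ and Q = ⊗ᵢ Qᵢ on Πᵢ αᵢ satisfy P ≪ Q and ∫ (dP/dQ)^λ dQ ≤ exp( (λ−1)·∑ᵢ εᵢ ); i.e., if each mechanism is (λ, εᵢ)-RDP then their composition is (λ, ∑ᵢ εᵢ)-RDP. -/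

import Mathlib

open Real MeasureTheory

/-- The product of measures given by densities with respect to probability measures is given by
the product density. -/
theorem pi_withDensity_eq_withDensity_prod {I : Type*} [Fintype I] {α : I → Type*}
    [∀ i, MeasurableSpace (α i)] (μ : ∀ i, Measure (α i)) [∀ i, IsProbabilityMeasure (μ i)]
    {f : ∀ i, α i → ENNReal} (hf : ∀ i, Measurable (f i))
    [∀ i, SigmaFinite ((μ i).withDensity (f i))] :
    Measure.pi (fun i => (μ i).withDensity (f i)) =
      (Measure.pi μ).withDensity (fun x => ∏ i, f i (x i)) := by
  refine Measure.pi_eq fun s hs => ?_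
  have hg (i : I) : Measurable ((s i).indicator (f i)) := (hf i).indicator (hs i)
  have hind : ProbabilityTheory.iIndepFun (fun i (x : ∀ i, α i) => (s i).indicator (f i) (x i))
      (Measure.pi μ) := ProbabilityTheory.iIndepFun_pi fun i => (hg i).aemeasurable
  have hprod := ProbabilityTheory.lintegral_prod_eq_prod_lintegral_of_indepFun Finset.univ _ hind
    fun i => (hg i).comp (measurable_pi_apply i)
  have hset : MeasurableSet (Set.pi Set.univ s) := MeasurableSet.univ_pi hs
  rw [withDensity_apply _ hset, ← lintegral_indicator hset]
  calc
    _ = ∫⁻ x, ∏ i, (s i).indicator (f i) (x i) ∂(Measure.pi μ) := by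
      refine lintegral_congr fun x => ?_
      by_cases hx : x ∈ Set.pi Set.univ s
      · rw [Set.indicator_of_mem hx]
        exact Finset.prod_congr rfl fun i _ => (Set.indicator_of_mem (hx i trivial) _).symm
      · rw [Set.indicator_of_notMem hx]
        obtain ⟨i, hi⟩ : ∃ i, x i ∉ s i := by simpa [Set.mem_pi] using hx
        exact (Finset.prod_eq_zero (Finset.mem_univ i) (Set.indicator_of_notMem hi _)).symm
    _ = _ := by
      rw [hprod]
      refine Finset.prod_congr rfl fun i _ => ?_
      rw [withDensity_apply _ (hs i), ← lintegral_indicator (hs i),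
        ← (measurePreserving_eval μ i).lintegral_comp (hg i)]

/-- Composition of Rényi differential privacy for independent mechanisms: if each pair
`(Pᵢ, Qᵢ)` satisfies `Pᵢ ≪ Qᵢ` and `∫ (dPᵢ/dQᵢ)^λ dQᵢ ≤ exp ((λ-1) εᵢ)`, then the product
measures satisfy `⊗ᵢ Pᵢ ≪ ⊗ᵢ Qᵢ` and `∫ (d(⊗P)/d(⊗Q))^λ d(⊗Q) ≤ exp ((λ-1) ∑ᵢ εᵢ)`. -/
theorem rdp_composition {I : Type*} [Fintype I] {α : I → Type*}
    [∀ i, MeasurableSpace (α i)] (P Q : ∀ i, Measure (α i))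
    [∀ i, IsProbabilityMeasure (P i)] [∀ i, IsProbabilityMeasure (Q i)]
    (hac : ∀ i, P i ≪ Q i) (l : ℝ) (hl : 1 < l) (ε : I → ℝ) (hε : ∀ i, 0 ≤ ε i)
    (hRDP : ∀ i, ∫ x, ((P i).rnDeriv (Q i) x).toReal ^ l ∂(Q i) ≤
      Real.exp ((l - 1) * ε i)) :
    Measure.pi P ≪ Measure.pi Q ∧
      ∫ x, ((Measure.pi P).rnDeriv (Measure.pi Q) x).toReal ^ l ∂(Measure.pi Q) ≤
        Real.exp ((l - 1) * ∑ i, ε i) := by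
  have hf (i : I) : Measurable ((P i).rnDeriv (Q i)) := Measure.measurable_rnDeriv _ _
  have hP : Measure.pi P =
      (Measure.pi Q).withDensity (fun x => ∏ i, (P i).rnDeriv (Q i) (x i)) := by
    rw [← pi_withDensity_eq_withDensity_prod Q hf]
    congr with i : 1
    exact (Measure.withDensity_rnDeriv_eq _ _ (hac i)).symm
  have hmeas : Measurable fun x : ∀ i, α i => ∏ i, (P i).rnDeriv (Q i) (x i) :=
    Finset.measurable_fun_prod _ fun i _ => (hf i).comp (measurable_pi_apply i)
  have hrn : (Measure.pi P).rnDeriv (Measure.pi Q) =ᵐ[Measure.pi Q]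
      fun x => ∏ i, (P i).rnDeriv (Q i) (x i) := by
    rw [hP]
    exact Measure.rnDeriv_withDensity _ hmeas
  refine ⟨hP ▸ withDensity_absolutelyContinuous _ _, ?_⟩
  calc
    _ = ∫ x, ∏ i, ((P i).rnDeriv (Q i) (x i)).toReal ^ l ∂(Measure.pi Q) := by
      refine integral_congr_ae (hrn.mono fun x hx => ?_)
      simp only [hx, ENNReal.toReal_prod]
      exact (Real.finsetProd_rpow _ _ (fun i _ => ENNReal.toReal_nonneg) l).symm
    _ = ∏ i, ∫ x, ((P i).rnDeriv (Q i) x).toReal ^ l ∂(Q i) :=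
      integral_fintype_prod_eq_prod fun i x => ((P i).rnDeriv (Q i) x).toReal ^ l
    _ ≤ ∏ i, Real.exp ((l - 1) * ε i) :=
      Finset.prod_le_prod (fun i _ => integral_nonneg fun x => by positivity) fun i _ => hRDP i
    _ = _ := by rw [← Real.exp_sum, Finset.mul_sum]
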